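/- arXiv:1205.2051 — 4 statements merged into one kernel-verified Lean document; each statement's English description precedes it below -/
import Mathlib

section
/- Suppose t≥4 and u,w are a pair of indistinguishable neighbours of a node v of order k in round t. Then u and w are a pair of indistinguishable neighbours of v of order k+1 in round t−2. -/
namespace Weak

/-- The degree of a vertex. -/
noncomputable def deg {n : ℕ} (G : SimpleGraph (Fin n)) (v : Fin n) : ℕ :=
  Nat.card {u : Fin n // G.Adj v u}

/-- A port of a graph: a pair (v, i) with i ∈ [deg v]. -/
abbrev Port {n : ℕ} (G : SimpleGraph (Fin n)) : Type := Σ v : Fin n, Fin (deg G v)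

/-- A port numbering: a bijection on ports with A(p) = A(G). -/
structure PortNumbering {n : ℕ} (G : SimpleGraph (Fin n)) where
  p : Port G ≃ Port G
  adj : ∀ u v : Fin n, (∃ i : Fin (deg G u), (p ⟨u, i⟩).1 = v) ↔ G.Adj u v

/-- A consistent port numbering is an involution. -/
def PortNumbering.Consistent {n : ℕ} {G : SimpleGraph (Fin n)} (pn : PortNumbering G) : Prop :=
  ∀ q : Port G, pn.p (pn.p q) = q

/-- A distributed state machine for F(Δ), with stopping states Y. -/
structure DSM (Y : Type) (Δ : ℕ) where
  Z : Type
  z₀ : Fin (Δ + 1) → Y ⊕ Z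
  M : Type
  m₀ : M
  μ : Z → Fin Δ → M
  δ : Z → (Fin Δ → M) → Y ⊕ Z

namespace DSM

variable {Y : Type} {Δ : ℕ}

/-- μ extended to stopping states: a stopped node sends the dummy message. -/
def μ' (A : DSM Y Δ) : Y ⊕ A.Z → Fin Δ → A.M
  | Sum.inl _ => fun _ => A.m₀
  | Sum.inr z => A.μ z

/-- δ extended to stopping states: a stopped node no longer changes state. -/
def δ' (A : DSM Y Δ) : Y ⊕ A.Z → (Fin Δ → A.M) → Y ⊕ A.Z
  | Sum.inl y, _ => Sum.inl y
  | Sum.inr z, m => A.δ z m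

/-- Machines whose transition depends only on the multiset of received messages. -/
def InMultiset (A : DSM Y Δ) : Prop :=
  ∀ (z : A.Z) (a b : Fin Δ → A.M),
    (List.ofFn a : Multiset A.M) = (List.ofFn b : Multiset A.M) → A.δ z a = A.δ z b

/-- Machines whose transition depends only on the set of received messages. -/
def InSet (A : DSM Y Δ) : Prop :=
  ∀ (z : A.Z) (a b : Fin Δ → A.M), Set.range a = Set.range b → A.δ z a = A.δ z b

/-- Machines that send the same message to all ports. -/
def InBroadcast (A : DSM Y Δ) : Prop :=
  ∀ (z : A.Z) (i j : Fin Δ), A.μ z i = A.μ z j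

end DSM

/-- The execution of a machine in (G, p): the state of node u at time t. -/
noncomputable def exec {Y : Type} {Δ n : ℕ} (A : DSM Y Δ) (G : SimpleGraph (Fin n))
    (hG : ∀ v, deg G v ≤ Δ) (pn : PortNumbering G) : ℕ → Fin n → Y ⊕ A.Z
  | 0, u => A.z₀ ⟨deg G u, Nat.lt_succ_of_le (hG u)⟩
  | t + 1, u =>
      A.δ' (exec A G hG pn t u) fun k =>
        if h : (k : ℕ) < deg G u then
          A.μ' (exec A G hG pn t (pn.p.symm ⟨u, ⟨(k : ℕ), h⟩⟩).1)
            ⟨((pn.p.symm ⟨u, ⟨(k : ℕ), h⟩⟩).2 : ℕ),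
              lt_of_lt_of_le (pn.p.symm ⟨u, ⟨(k : ℕ), h⟩⟩).2.isLt (hG _)⟩
        else A.m₀

/-- A graph problem: for each graph, a set of admissible outputs. -/
abbrev GraphProblem (Y : Type) : Type :=
  ∀ n : ℕ, SimpleGraph (Fin n) → Set ((Fin n) → Y)

/-- A sequence of machines solves a problem in time T. -/
def SolvesInTime {Y : Type} (A : ∀ Δ : ℕ, DSM Y Δ) (P : GraphProblem Y)
    (T : ℕ → ℕ → ℕ) : Prop :=
  ∀ (Δ n : ℕ) (G : SimpleGraph (Fin n)) (hG : ∀ v, deg G v ≤ Δ) (pn : PortNumbering G),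
    ∃ S ∈ P n G, ∀ u, exec (A Δ) G hG pn (T Δ n) u = Sum.inl (S u)

/-- A sequence of machines solves a problem in time T assuming consistency. -/
def SolvesInTimeConsistent {Y : Type} (A : ∀ Δ : ℕ, DSM Y Δ) (P : GraphProblem Y)
    (T : ℕ → ℕ → ℕ) : Prop :=
  ∀ (Δ n : ℕ) (G : SimpleGraph (Fin n)) (hG : ∀ v, deg G v ≤ Δ) (pn : PortNumbering G),
    pn.Consistent →
    ∃ S ∈ P n G, ∀ u, exec (A Δ) G hG pn (T Δ n) u = Sum.inl (S u)

/-- Problem class VV. -/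
def VV {Y : Type} (P : GraphProblem Y) : Prop :=
  ∃ A : ∀ Δ : ℕ, DSM Y Δ, ∃ T, SolvesInTime A P T

/-- Problem class MV. -/
def MV {Y : Type} (P : GraphProblem Y) : Prop :=
  ∃ A : ∀ Δ : ℕ, DSM Y Δ, (∀ Δ, (A Δ).InMultiset) ∧ ∃ T, SolvesInTime A P T

/-- Problem class SV. -/
def SV {Y : Type} (P : GraphProblem Y) : Prop :=
  ∃ A : ∀ Δ : ℕ, DSM Y Δ, (∀ Δ, (A Δ).InSet) ∧ ∃ T, SolvesInTime A P T

/-- Problem class VB. -/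
def VB {Y : Type} (P : GraphProblem Y) : Prop :=
  ∃ A : ∀ Δ : ℕ, DSM Y Δ, (∀ Δ, (A Δ).InBroadcast) ∧ ∃ T, SolvesInTime A P T

/-- Problem class MB. -/
def MB {Y : Type} (P : GraphProblem Y) : Prop :=
  ∃ A : ∀ Δ : ℕ, DSM Y Δ, (∀ Δ, (A Δ).InMultiset ∧ (A Δ).InBroadcast) ∧ ∃ T, SolvesInTime A P T

/-- Problem class SB. -/
def SB {Y : Type} (P : GraphProblem Y) : Prop :=
  ∃ A : ∀ Δ : ℕ, DSM Y Δ, (∀ Δ, (A Δ).InSet ∧ (A Δ).InBroadcast) ∧ ∃ T, SolvesInTime A P T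

/-- Problem class VVc. -/
def VVc {Y : Type} (P : GraphProblem Y) : Prop :=
  ∃ A : ∀ Δ : ℕ, DSM Y Δ, ∃ T, SolvesInTimeConsistent A P T

/-- Constant-time problem class VV(1). -/
def VV1 {Y : Type} (P : GraphProblem Y) : Prop :=
  ∃ A : ∀ Δ : ℕ, DSM Y Δ, ∃ T' : ℕ → ℕ, SolvesInTime A P fun Δ _ => T' Δ

/-- Constant-time problem class MV(1). -/
def MV1 {Y : Type} (P : GraphProblem Y) : Prop :=
  ∃ A : ∀ Δ : ℕ, DSM Y Δ, (∀ Δ, (A Δ).InMultiset) ∧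
    ∃ T' : ℕ → ℕ, SolvesInTime A P fun Δ _ => T' Δ

/-- Constant-time problem class SV(1). -/
def SV1 {Y : Type} (P : GraphProblem Y) : Prop :=
  ∃ A : ∀ Δ : ℕ, DSM Y Δ, (∀ Δ, (A Δ).InSet) ∧
    ∃ T' : ℕ → ℕ, SolvesInTime A P fun Δ _ => T' Δ

/-- Constant-time problem class VB(1). -/
def VB1 {Y : Type} (P : GraphProblem Y) : Prop :=
  ∃ A : ∀ Δ : ℕ, DSM Y Δ, (∀ Δ, (A Δ).InBroadcast) ∧
    ∃ T' : ℕ → ℕ, SolvesInTime A P fun Δ _ => T' Δ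

/-- Constant-time problem class MB(1). -/
def MB1 {Y : Type} (P : GraphProblem Y) : Prop :=
  ∃ A : ∀ Δ : ℕ, DSM Y Δ, (∀ Δ, (A Δ).InMultiset ∧ (A Δ).InBroadcast) ∧
    ∃ T' : ℕ → ℕ, SolvesInTime A P fun Δ _ => T' Δ

/-- Constant-time problem class SB(1). -/
def SB1 {Y : Type} (P : GraphProblem Y) : Prop :=
  ∃ A : ∀ Δ : ℕ, DSM Y Δ, (∀ Δ, (A Δ).InSet ∧ (A Δ).InBroadcast) ∧
    ∃ T' : ℕ → ℕ, SolvesInTime A P fun Δ _ => T' Δ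

/-- Constant-time problem class VVc(1). -/
def VVc1 {Y : Type} (P : GraphProblem Y) : Prop :=
  ∃ A : ∀ Δ : ℕ, DSM Y Δ, ∃ T' : ℕ → ℕ, SolvesInTimeConsistent A P fun Δ _ => T' Δ

end Weak
namespace Weak

/-- The type of the history values β_t. -/
def BetaType : ℕ → Type
  | 0 => Unit
  | t + 1 => BetaType t × Set (BetaType t × ℕ × ℕ)

/-- The outgoing port number at u that is connected to v. -/
noncomputable def portTo {n : ℕ} {G : SimpleGraph (Fin n)} (pn : PortNumbering G)
    (u v : Fin n) : ℕ :=
  sInf { i : ℕ | ∃ h : i < deg G u, (pn.p ⟨u, ⟨i, h⟩⟩).1 = v }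

/-- The pair (β_t, B_t): β_t(v) is the local history of v, and B_t(v) is the set of
messages (β_t(u), deg(u), π(u,v)) received by v in round t. -/
noncomputable def betaB {n : ℕ} (G : SimpleGraph (Fin n)) (pn : PortNumbering G) :
    ∀ t : ℕ, (Fin n → BetaType t) × (Fin n → Set (BetaType t × ℕ × ℕ))
  | 0 => (fun _ => (), fun _ => ∅)
  | t + 1 =>
      let prev := betaB G pn t
      let β : Fin n → BetaType (t + 1) := fun v => (prev.1 v, prev.2 v)
      (β, fun v => { m | ∃ u, G.Adj v u ∧ m = (β u, deg G u, portTo pn u v) })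

/-- β_t(v). -/
noncomputable def beta {n : ℕ} (G : SimpleGraph (Fin n)) (pn : PortNumbering G)
    (t : ℕ) (v : Fin n) : BetaType t :=
  (betaB G pn t).1 v

/-- u and w are a pair of indistinguishable neighbours of v in round t. -/
def IndistPair {n : ℕ} (G : SimpleGraph (Fin n)) (pn : PortNumbering G)
    (t : ℕ) (v u w : Fin n) : Prop :=
  u ≠ w ∧ G.Adj v u ∧ G.Adj v w ∧
    beta G pn t u = beta G pn t w ∧ deg G u = deg G w ∧ portTo pn u v = portTo pn w v

/-- u and w are a pair of indistinguishable neighbours of v of order k in round t. -/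
def IndistPairOrder {n : ℕ} (G : SimpleGraph (Fin n)) (pn : PortNumbering G)
    (t k : ℕ) (v u w : Fin n) : Prop :=
  IndistPair G pn t v u w ∧
    ∃ s : Finset (Fin n), s.card = k ∧ ∀ x ∈ s, G.Adj v x ∧ beta G pn t u = beta G pn t x

end Weak
namespace Weak

theorem portTo_spec {n : ℕ} {G : SimpleGraph (Fin n)} (pn : PortNumbering G) {u v : Fin n}
    (h : G.Adj u v) : ∃ hi : portTo pn u v < deg G u, (pn.p ⟨u, ⟨portTo pn u v, hi⟩⟩).1 = v := by
  obtain ⟨i, hi⟩ := (pn.adj u v).2 h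
  exact Nat.sInf_mem (s := { i : ℕ | ∃ h : i < deg G u, (pn.p ⟨u, ⟨i, h⟩⟩).1 = v })
    ⟨i, i.isLt, hi⟩

/-- Distinct neighbours of a node are reached through distinct ports. -/
theorem portTo_injOn {n : ℕ} {G : SimpleGraph (Fin n)} (pn : PortNumbering G) {u a b : Fin n}
    (ha : G.Adj u a) (hb : G.Adj u b) (h : portTo pn u a = portTo pn u b) : a = b := by
  obtain ⟨hi, hpa⟩ := portTo_spec pn ha
  obtain ⟨hj, hpb⟩ := portTo_spec pn hb
  rw [← hpa, ← hpb]
  congr 4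

/-- Equal histories have equal prefixes. -/
theorem beta_eq_of_beta_succ_eq {n : ℕ} {G : SimpleGraph (Fin n)} {pn : PortNumbering G} {r : ℕ}
    {a b : Fin n} (h : beta G pn (r + 1) a = beta G pn (r + 1) b) :
    beta G pn r a = beta G pn r b :=
  congrArg Prod.fst h

/-- Nodes with equal histories received equal messages: every neighbour of one of them is matched
by a neighbour of the other with the same history, degree and port number. -/
theorem exists_adj_of_beta_eq {n : ℕ} {G : SimpleGraph (Fin n)} {pn : PortNumbering G} {r : ℕ}
    {a b c : Fin n} (h : beta G pn (r + 2) a = beta G pn (r + 2) b) (hc : G.Adj a c) :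
    ∃ d, G.Adj b d ∧ beta G pn (r + 1) c = beta G pn (r + 1) d ∧ deg G c = deg G d ∧
      portTo pn c a = portTo pn d b := by
  have hB : (betaB G pn (r + 1)).2 a = (betaB G pn (r + 1)).2 b := congrArg Prod.snd h
  have hm : (beta G pn (r + 1) c, deg G c, portTo pn c a) ∈ (betaB G pn (r + 1)).2 a :=
    ⟨c, hc, rfl⟩
  rw [hB] at hm
  obtain ⟨d, hd, he⟩ := hm
  exact ⟨d, hd, congrArg Prod.fst he, congrArg (fun m => m.2.1) he, congrArg (fun m => m.2.2) he⟩

/-- Lemma: an indistinguishable pair of order k in round t ≥ 4 was a pair of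
order k + 1 in round t − 2. -/
theorem indist_pair_order_step {Δ n : ℕ} (G : SimpleGraph (Fin n))
    (hG : ∀ v, deg G v ≤ Δ) (pn : PortNumbering G) (t k : ℕ) (ht : 4 ≤ t)
    (v u w : Fin n) (h : IndistPairOrder G pn t k v u w) :
    IndistPairOrder G pn (t - 2) (k + 1) v u w := by
  obtain ⟨r, rfl⟩ : ∃ r, t = r + 3 := ⟨t - 3, by omega⟩
  rw [show r + 3 - 2 = r + 1 by omega]
  obtain ⟨⟨huw, hvu, hvw, hβ, hdeg, hport⟩, s, rfl, hs⟩ := h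
  have hβ' : beta G pn (r + 1) u = beta G pn (r + 1) w :=
    beta_eq_of_beta_succ_eq (beta_eq_of_beta_succ_eq hβ)
  refine ⟨⟨huw, hvu, hvw, hβ', hdeg, hport⟩, ?_⟩
  have key : ∀ a : s, ∃ x y, G.Adj u y ∧ portTo pn v a = portTo pn y u ∧ G.Adj v x ∧
      beta G pn (r + 1) u = beta G pn (r + 1) x ∧ portTo pn u y = portTo pn x v := by
    rintro ⟨a, ha⟩
    obtain ⟨hva, hua⟩ := hs a ha
    obtain ⟨y, huy, hβy, -, hpy⟩ := exists_adj_of_beta_eq hua.symm hva.symm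
    obtain ⟨x, hvx, hβx, -, hpx⟩ := exists_adj_of_beta_eq hβy.symm huy.symm
    exact ⟨x, y, huy, hpy, hvx, hβx, hpx⟩
  choose x y huy hpy hvx hβx hpx using key
  have hinj : ∀ a b, portTo pn (x a) v = portTo pn (x b) v → a = b := by
    intro a b hab
    have hy : y a = y b := portTo_injOn pn (huy a) (huy b) (by rw [hpx, hpx, hab])
    exact Subtype.ext (portTo_injOn pn (hs a a.2).1 (hs b b.2).1 (by rw [hpy, hpy, hy]))
  have hcard : (Finset.univ.image x).card = s.card := by
    rw [Finset.card_image_of_injective _ fun a b hab => hinj a b (by rw [hab])]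
    simp
  obtain ⟨z, hz, hvz, hβz⟩ : ∃ z, z ∉ Finset.univ.image x ∧ G.Adj v z ∧
      beta G pn (r + 1) u = beta G pn (r + 1) z := by
    by_cases hu : u ∈ Finset.univ.image x
    · refine ⟨w, fun hw => huw ?_, hvw, hβ'⟩
      obtain ⟨a, -, ha⟩ := Finset.mem_image.1 hu
      obtain ⟨b, -, hb⟩ := Finset.mem_image.1 hw
      rw [← ha, ← hb, hinj a b (by rw [ha, hb, hport])]
    · exact ⟨u, hu, hvu, rfl⟩
  refine ⟨insert z (Finset.univ.image x), by rw [Finset.card_insert_of_notMem hz, hcard], ?_⟩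
  intro c hc
  rcases Finset.mem_insert.1 hc with rfl | hc
  · exact ⟨hvz, hβz⟩
  · obtain ⟨a, -, rfl⟩ := Finset.mem_image.1 hc
    exact ⟨hvx a, hβx a⟩
end Weak
end

section
/- The problem classes MV and SV coincide, and the constant-time classes MV(1) and SV(1) coincide: a graph problem is solvable by a sequence of Multiset machines if and only if it is solvable by a sequence of Set machines, and the same holds with 'solvable in constant time'. -/
namespace Weak
section Counting

variable {V : Type*} [Fintype V] (G : SimpleGraph V) (out : V → V → ℕ) (code : ℕ → V → ℕ)

open Classical in
/-- The neighbours of `a` whose code at time `t` is `c`. -/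
noncomputable def coded (t : ℕ) (a : V) (c : ℕ) : Finset V :=
  Finset.univ.filter fun x => G.Adj a x ∧ code t x = c

open Classical in
lemma mem_coded {t : ℕ} {a : V} {c : ℕ} {x : V} :
    x ∈ coded G code t a c ↔ G.Adj a x ∧ code t x = c := by
  simp [coded]

variable (hout : ∀ v a b, G.Adj v a → G.Adj v b → out v a = out v b → a = b)
  (hstep : ∀ t a b, code (t + 1) a = code (t + 1) b →
    ∀ x, G.Adj a x → ∃ y, G.Adj b y ∧ code t y = code t x ∧ out y b = out x a)

include hout hstep in
lemma card_coded_le_card_image {t : ℕ} {a b : V} :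
    (coded G code (t + 1) a (code (t + 1) b)).card ≤
      ((coded G code t b (code t a)).image fun y => out y b).card := by
  refine Finset.card_le_card_of_injOn (out a) ?_ ?_
  · intro x hx
    obtain ⟨hax, hx⟩ := (mem_coded G code).1 hx
    obtain ⟨y, hy, hc, ho⟩ := hstep t x b hx a hax.symm
    exact Finset.mem_coe.2 (Finset.mem_image.2 ⟨y, (mem_coded G code).2 ⟨hy, hc⟩, ho⟩)
  · intro x hx y hy h
    exact hout a x y ((mem_coded G code).1 hx).1 ((mem_coded G code).1 hy).1 h

include hout hstep in
lemma add_two_le_card_coded (hmono : ∀ t a b, code (t + 1) a = code (t + 1) b → code t a = code t b)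
    {u v w : V} (hv : G.Adj u v) (hw : G.Adj u w)
    (hvw : v ≠ w) (ho : out v u = out w u) (j : ℕ) :
    ∀ t, code (t + 2 * j) v = code (t + 2 * j) w →
      j + 2 ≤ (coded G code t u (code t v)).card := by
  have hanti : ∀ s t, code (t + s) v = code (t + s) w → code t v = code t w := by
    intro s
    induction s with
    | zero => intro t h; exact h
    | succ s ih => intro t h; exact ih t (hmono _ _ _ h)
  have hmem : ∀ t, code t v = code t w →
      v ∈ coded G code t u (code t v) ∧ w ∈ coded G code t u (code t v) := fun t h =>
    ⟨(mem_coded G code).2 ⟨hv, rfl⟩, (mem_coded G code).2 ⟨hw, h.symm⟩⟩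
  induction j with
  | zero =>
    intro t h
    obtain ⟨h₁, h₂⟩ := hmem t h
    exact Finset.one_lt_card.2 ⟨v, h₁, w, h₂, hvw⟩
  | succ j ih =>
    intro t h
    have hd := ih (t + 1 + 1) (by rwa [show t + 1 + 1 + 2 * j = t + 2 * (j + 1) by ring])
    obtain ⟨h₁, h₂⟩ := hmem t (hanti _ _ h)
    have e₁ := card_coded_le_card_image G out code hout hstep (t := t + 1) (a := u) (b := v)
    have e₂ := card_coded_le_card_image G out code hout hstep (t := t) (a := v) (b := u)
    have e₃ := Finset.card_image_le (s := coded G code (t + 1) v (code (t + 1) u))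
      (f := fun y => out y v)
    have e₄ : ((coded G code t u (code t v)).image fun y => out y u).card <
        (coded G code t u (code t v)).card := by
      refine lt_of_le_of_ne Finset.card_image_le fun h => hvw ?_
      exact Finset.card_image_iff.1 h h₁ h₂ ho
    omega

end Counting

section Ports

variable {n : ℕ} {G : SimpleGraph (Fin n)} (pn : PortNumbering G)

lemma PortNumbering.adj_of_port (q : Port G) : G.Adj q.1 (pn.p q).1 :=
  (pn.adj q.1 _).1 ⟨q.2, rfl⟩

lemma PortNumbering.fst_injective (v : Fin n) :
    Function.Injective fun i : Fin (deg G v) => (pn.p ⟨v, i⟩).1 := by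
  classical
  let f : Fin (deg G v) → {u : Fin n // G.Adj v u} :=
    fun i => ⟨(pn.p ⟨v, i⟩).1, pn.adj_of_port ⟨v, i⟩⟩
  have hf : Function.Surjective f := by
    rintro ⟨u, hu⟩
    obtain ⟨i, hi⟩ := (pn.adj v u).2 hu
    exact ⟨i, Subtype.ext hi⟩
  have hb : Function.Bijective f :=
    (Fintype.bijective_iff_surjective_and_card f).2
      ⟨hf, by rw [Fintype.card_fin, deg, Nat.card_eq_fintype_card]⟩
  intro i j h
  exact hb.1 (Subtype.ext h)

open Classical in
/-- The number of the port of `v` that leads to `u`. -/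
noncomputable def PortNumbering.out (v u : Fin n) : ℕ :=
  if h : ∃ i : Fin (deg G v), (pn.p ⟨v, i⟩).1 = u then (h.choose : ℕ) else 0

lemma PortNumbering.out_port (q : Port G) : pn.out q.1 (pn.p q).1 = q.2 := by
  have h : ∃ i : Fin (deg G q.1), (pn.p ⟨q.1, i⟩).1 = (pn.p q).1 := ⟨q.2, rfl⟩
  rw [PortNumbering.out, dif_pos h]
  exact congrArg Fin.val (pn.fst_injective q.1 h.choose_spec)

lemma PortNumbering.exists_port {v u : Fin n} (h : G.Adj v u) :
    ∃ q : Port G, q.1 = v ∧ (pn.p q).1 = u := by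
  obtain ⟨i, hi⟩ := (pn.adj v u).2 h
  exact ⟨⟨v, i⟩, rfl, hi⟩

lemma PortNumbering.out_injective (v a b : Fin n) (ha : G.Adj v a) (hb : G.Adj v b)
    (h : pn.out v a = pn.out v b) : a = b := by
  obtain ⟨i, rfl⟩ := (pn.adj v a).2 ha
  obtain ⟨j, rfl⟩ := (pn.adj v b).2 hb
  have h₁ := pn.out_port ⟨v, i⟩
  have h₂ := pn.out_port ⟨v, j⟩
  have : i = j := Fin.ext (h₁.symm.trans (h.trans h₂))
  rw [this]

/-- What node `u` receives when `f q` is sent from every port `q`, padded with `d`. -/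
noncomputable def PortNumbering.recv (Δ : ℕ) {α : Type} (f : Port G → α) (d : α) (u : Fin n) :
    Fin Δ → α :=
  fun k => if h : (k : ℕ) < deg G u then f (pn.p.symm ⟨u, ⟨(k : ℕ), h⟩⟩) else d

lemma PortNumbering.comp_recv (Δ : ℕ) {α β : Type} (g : α → β) (f : Port G → α) (d : α)
    (u : Fin n) : g ∘ pn.recv Δ f d u = pn.recv Δ (g ∘ f) (g d) u := by
  funext k
  simp only [PortNumbering.recv, Function.comp_apply]
  split <;> rfl

lemma PortNumbering.recv_port {Δ : ℕ} (hG : ∀ v, deg G v ≤ Δ) {α : Type} (f : Port G → α) (d : α)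
    (q : Port G) : ∃ k, pn.recv Δ f d (pn.p q).1 k = f q := by
  refine ⟨⟨(pn.p q).2, (pn.p q).2.isLt.trans_le (hG _)⟩, ?_⟩
  simp [PortNumbering.recv]

lemma PortNumbering.recv_some {Δ : ℕ} {α : Type} (f : Port G → Option α) {u : Fin n} {k : Fin Δ}
    (hk : pn.recv Δ f none u k ≠ none) :
    ∃ h : (k : ℕ) < deg G u, pn.recv Δ f none u k = f (pn.p.symm ⟨u, ⟨(k : ℕ), h⟩⟩) := by
  by_cases h : (k : ℕ) < deg G u
  · exact ⟨h, by simp [PortNumbering.recv, h]⟩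
  · simp [PortNumbering.recv, h] at hk

/-- The code of the history of a node after `t` rounds, in each of which every node sends its
history together with the number of the outgoing port, and remembers the set it receives. -/
noncomputable def PortNumbering.history (Δ : ℕ) : ℕ → Fin n → ℕ
  | 0, _ => 0
  | t + 1, u => Encodable.encode (PortNumbering.history Δ t u,
      Finset.univ.image (pn.recv Δ
        (fun q => some (PortNumbering.history Δ t q.1, (q.2 : ℕ))) none u))

lemma PortNumbering.history_succ_inj {Δ t : ℕ} {a b : Fin n}
    (h : pn.history Δ (t + 1) a = pn.history Δ (t + 1) b) :
    pn.history Δ t a = pn.history Δ t b ∧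
      Finset.univ.image (pn.recv Δ (fun q => some (pn.history Δ t q.1, (q.2 : ℕ))) none a) =
      Finset.univ.image (pn.recv Δ (fun q => some (pn.history Δ t q.1, (q.2 : ℕ))) none b) := by
  simpa only [Prod.mk.injEq] using Encodable.encode_injective h

lemma PortNumbering.history_step {Δ : ℕ} (hG : ∀ v, deg G v ≤ Δ) (t : ℕ) (a b : Fin n)
    (h : pn.history Δ (t + 1) a = pn.history Δ (t + 1) b) (x : Fin n) (hx : G.Adj a x) :
    ∃ y, G.Adj b y ∧ pn.history Δ t y = pn.history Δ t x ∧ pn.out y b = pn.out x a := by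
  obtain ⟨q, rfl, rfl⟩ := pn.exists_port hx.symm
  obtain ⟨k, hk⟩ := pn.recv_port hG
    (fun q : Port G => some (pn.history Δ t q.1, (q.2 : ℕ))) none q
  have hmem := Finset.mem_image_of_mem
    (pn.recv Δ (fun q : Port G => some (pn.history Δ t q.1, (q.2 : ℕ))) none (pn.p q).1)
    (Finset.mem_univ k)
  rw [(pn.history_succ_inj h).2, hk] at hmem
  obtain ⟨l, -, hl⟩ := Finset.mem_image.1 hmem
  obtain ⟨h', e⟩ := pn.recv_some _ (hl.symm ▸ Option.some_ne_none _)
  rw [e] at hl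
  have h₁ := pn.adj_of_port (pn.p.symm ⟨b, ⟨l, h'⟩⟩)
  have h₂ := pn.out_port (pn.p.symm ⟨b, ⟨l, h'⟩⟩)
  rw [Equiv.apply_symm_apply] at h₁ h₂
  simp only [Option.some.injEq, Prod.mk.injEq] at hl
  exact ⟨_, h₁.symm, hl.1, h₂.trans (hl.2.trans (pn.out_port q).symm)⟩

/-- After `2Δ` rounds, ports leading to a common node are told apart by their number and the
history of their node. -/
lemma PortNumbering.port_ext {Δ : ℕ} (hG : ∀ v, deg G v ≤ Δ) {q r : Port G}
    (hqr : (pn.p q).1 = (pn.p r).1) (hnum : (q.2 : ℕ) = r.2)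
    (hh : pn.history Δ (2 * Δ) q.1 = pn.history Δ (2 * Δ) r.1) : q = r := by
  by_contra hne
  have hne' : q.1 ≠ r.1 := by
    intro h
    obtain ⟨v, i⟩ := q
    obtain ⟨w, j⟩ := r
    obtain rfl : v = w := h
    exact hne (congrArg (Sigma.mk v) (Fin.ext hnum))
  have ho : pn.out q.1 (pn.p q).1 = pn.out r.1 (pn.p q).1 := by
    rw [pn.out_port q, hqr, pn.out_port r, hnum]
  have hcard := add_two_le_card_coded G pn.out (pn.history Δ) pn.out_injective
    (pn.history_step hG) (fun t a b h => (pn.history_succ_inj h).1)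
    (pn.adj_of_port q).symm (hqr ▸ (pn.adj_of_port r).symm) hne' ho Δ 0 (by simpa using hh)
  have hle : (coded G (pn.history Δ) 0 (pn.p q).1 (pn.history Δ 0 q.1)).card ≤
      deg G (pn.p q).1 := by
    classical
    rw [deg, Nat.card_eq_fintype_card, Fintype.card_subtype]
    exact Finset.card_le_card fun x hx =>
      Finset.mem_filter.2 ⟨Finset.mem_univ _, ((mem_coded G _).1 hx).1⟩
  have := hG (pn.p q).1
  omega

end Ports

section Reconstruction

variable {Δ : ℕ} {α : Type}

/-- No value other than `none` is taken twice. -/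
def InjOffNone (a : Fin Δ → Option α) : Prop :=
  ∀ k l, a k = a l → a k ≠ none → k = l

open Classical in
/-- A vector with set of entries `s` in which no entry other than `none` is repeated,
if there is one. -/
noncomputable def vectorOfSet (s : Set (Option α)) : Fin Δ → Option α :=
  if h : ∃ a : Fin Δ → Option α, Set.range a = s ∧ InjOffNone a then h.choose
  else fun _ => none

open Classical in
lemma coe_ofFn_eq_of_range_eq {a b : Fin Δ → Option α} (ha : InjOffNone a) (hb : InjOffNone b)
    (h : Set.range a = Set.range b) :
    (List.ofFn a : Multiset (Option α)) = (List.ofFn b : Multiset (Option α)) := by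
  have hcoe : ∀ c : Fin Δ → Option α,
      (List.ofFn c : Multiset (Option α)) = Finset.univ.val.map c := by
    intro c
    rw [List.ofFn_eq_map, ← Multiset.map_coe]
    rfl
  have hnodup : ∀ c : Fin Δ → Option α, InjOffNone c →
      ((List.ofFn c : Multiset (Option α)).filter (· ≠ none)).Nodup := by
    intro c hc
    rw [hcoe, Multiset.filter_map]
    refine Multiset.Nodup.map_on ?_ (Finset.univ.nodup.filter _)
    intro k hk l _ hkl
    exact hc k l hkl (Multiset.mem_filter.1 hk).2
  have hmem : ∀ x, x ∈ (List.ofFn a : Multiset (Option α)) ↔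
      x ∈ (List.ofFn b : Multiset (Option α)) := by
    intro x
    have := Set.ext_iff.1 h x
    simpa [List.mem_ofFn] using this
  have hfilter : (List.ofFn a : Multiset (Option α)).filter (· ≠ none) =
      (List.ofFn b : Multiset (Option α)).filter (· ≠ none) := by
    refine (Multiset.Nodup.ext (hnodup a ha) (hnodup b hb)).2 fun x => ?_
    rw [Multiset.mem_filter, Multiset.mem_filter, hmem]
  have hrep : ∀ c : Fin Δ → Option α,
      (List.ofFn c : Multiset (Option α)) =
        (List.ofFn c : Multiset (Option α)).filter (· ≠ none) + Multiset.replicate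
          (Δ - ((List.ofFn c : Multiset (Option α)).filter (· ≠ none)).card) none := by
    intro c
    have hadd := Multiset.filter_add_not (· ≠ none) (List.ofFn c : Multiset (Option α))
    have hcard := congrArg Multiset.card hadd
    rw [Multiset.card_add, Multiset.coe_card, List.length_ofFn] at hcard
    conv_lhs => rw [← hadd]
    congr 1
    refine Multiset.eq_replicate.2 ⟨by omega, fun x hx => ?_⟩
    exact not_not.1 (Multiset.mem_filter.1 hx).2
  rw [hrep a, hrep b, hfilter]

lemma coe_ofFn_vectorOfSet {a : Fin Δ → Option α} (ha : InjOffNone a) :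
    (List.ofFn (vectorOfSet (Set.range a) : Fin Δ → Option α) : Multiset (Option α)) =
      (List.ofFn a : Multiset (Option α)) := by
  have h : ∃ b : Fin Δ → Option α, Set.range b = Set.range a ∧ InjOffNone b :=
    ⟨a, rfl, ha⟩
  rw [vectorOfSet, dif_pos h]
  exact coe_ofFn_eq_of_range_eq h.choose_spec.2 ha h.choose_spec.1

end Reconstruction

namespace DSM

variable {Y : Type} {Δ : ℕ}

lemma InSet.inMultiset {A : DSM Y Δ} (hA : A.InSet) : A.InMultiset := by
  intro z a b h
  refine hA z a b (Set.ext fun x => ?_)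
  have : x ∈ (List.ofFn a : Multiset A.M) ↔ x ∈ (List.ofFn b : Multiset A.M) := by rw [h]
  simpa [List.mem_ofFn] using this

lemma InMultiset.δ'_eq {A : DSM Y Δ} (hA : A.InMultiset) (x : Y ⊕ A.Z) (a b : Fin Δ → A.M)
    (h : (List.ofFn a : Multiset A.M) = (List.ofFn b : Multiset A.M)) : A.δ' x a = A.δ' x b := by
  cases x with
  | inl y => rfl
  | inr z => exact hA z a b h

/-- The message of the simulated machine contained in a message `(history, port number, m)`. -/
def decode (A : DSM Y Δ) : Option (ℕ × ℕ × A.M) → A.M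
  | none => A.m₀
  | some m => m.2.2

/-- A state of the simulated machine as a state of the simulating one. -/
def embed (A : DSM Y Δ) (b : ℕ) : Y ⊕ A.Z → Y ⊕ (ℕ × ℕ × (Y ⊕ A.Z)) :=
  Sum.map id fun z => (0, b, Sum.inr z)

open Classical in
/-- The `Set` machine simulating a `Multiset` machine: it computes the history for `2Δ` rounds and
then runs the given machine, attaching the history and the port number to each message. A state
consists of the number of rounds left in the first phase, the history, and the simulated state. -/
noncomputable def toSet (A : DSM Y Δ) : DSM Y Δ where
  Z := ℕ × ℕ × (Y ⊕ A.Z)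
  z₀ d := Sum.inr (2 * Δ, 0, A.z₀ d)
  M := Option (ℕ × ℕ × A.M)
  m₀ := none
  μ z i := some (z.2.1, (i : ℕ), A.μ' z.2.2 i)
  δ z a := match z with
    | (c + 1, b, x) => Sum.inr (c,
        Encodable.encode (b, (Finset.univ.image a).image (Option.map fun m => (m.1, m.2.1))), x)
    | (0, b, x) => A.embed b (A.δ' x (A.decode ∘ vectorOfSet (Set.range a)))

lemma image_univ_eq_of_range_eq {ι α : Type} [Fintype ι] [DecidableEq α] {a b : ι → α}
    (h : Set.range a = Set.range b) : Finset.univ.image a = Finset.univ.image b := by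
  apply Finset.coe_injective
  simpa using h

lemma toSet_inSet (A : DSM Y Δ) : A.toSet.InSet := by
  classical
  intro z a b h
  obtain ⟨_ | c, e, x⟩ := z <;> simp only [toSet]
  · congr! 4
  · congr! 5
    exact congrArg _ (image_univ_eq_of_range_eq h)

end DSM

section Simulation

variable {Y : Type} {Δ n : ℕ} (A : DSM Y Δ) (G : SimpleGraph (Fin n))
  (hG : ∀ v, deg G v ≤ Δ) (pn : PortNumbering G)

/-- The message sent from port `q` in round `t + 1`. -/
noncomputable def sent (t : ℕ) (q : Port G) : A.M :=
  A.μ' (exec A G hG pn t q.1) ⟨(q.2 : ℕ), q.2.isLt.trans_le (hG _)⟩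

lemma exec_succ (t : ℕ) (u : Fin n) :
    exec A G hG pn (t + 1) u =
      A.δ' (exec A G hG pn t u) (pn.recv Δ (sent A G hG pn t) A.m₀ u) := rfl

lemma exec_toSet_history (t c : ℕ) (htc : t + c = 2 * Δ) (u : Fin n) :
    exec A.toSet G hG pn t u = Sum.inr (c, pn.history Δ t u, exec A G hG pn 0 u) := by
  classical
  induction t generalizing c u with
  | zero =>
    obtain rfl : c = 2 * Δ := by omega
    rfl
  | succ t ih =>
    have hsent : sent A.toSet G hG pn t = fun q =>
        some (pn.history Δ t q.1, (q.2 : ℕ), sent A G hG pn 0 q) := by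
      funext q
      rw [sent, ih (c + 1) (by omega)]
      rfl
    rw [exec_succ, ih (c + 1) (by omega), hsent]
    have himage (f : Port G → Option (ℕ × ℕ × A.M)) :
        (Finset.univ.image (pn.recv Δ f none u)).image (Option.map fun m => (m.1, m.2.1)) =
          Finset.univ.image (pn.recv Δ (Option.map (fun m => (m.1, m.2.1)) ∘ f) none u) := by
      rw [Finset.image_image, PortNumbering.comp_recv]
      rfl
    refine congrArg (fun b => Sum.inr (c, b, exec A G hG pn 0 u)) ?_
    rw [PortNumbering.history]
    refine congrArg (fun s => Encodable.encode (pn.history Δ t u, s)) ?_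
    exact himage fun q => some (pn.history Δ t q.1, (q.2 : ℕ), sent A G hG pn 0 q)

/-- The state `s` of the simulating machine, with history `b`, represents the state `x`. -/
def Represents (b : ℕ) (s : Y ⊕ (ℕ × ℕ × (Y ⊕ A.Z))) (x : Y ⊕ A.Z) : Prop :=
  s = A.embed b x ∨ s = Sum.inr (0, b, x)

lemma Represents.message {A : DSM Y Δ} {b : ℕ} {s : Y ⊕ (ℕ × ℕ × (Y ⊕ A.Z))} {x : Y ⊕ A.Z}
    (h : Represents A b s x) (i : Fin Δ) :
    A.decode (A.toSet.μ' s i) = A.μ' x i ∧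
      (A.toSet.μ' s i = (none : Option (ℕ × ℕ × A.M)) ∨
        A.toSet.μ' s i = (some (b, (i : ℕ), A.μ' x i) : Option (ℕ × ℕ × A.M))) := by
  rcases h with rfl | rfl
  · cases x with
    | inl y => exact ⟨rfl, Or.inl rfl⟩
    | inr z => exact ⟨rfl, Or.inr rfl⟩
  · exact ⟨rfl, Or.inr rfl⟩

lemma exec_toSet_step (hA : A.InMultiset) (t : ℕ)
    (ih : ∀ u, Represents A (pn.history Δ (2 * Δ) u) (exec A.toSet G hG pn (2 * Δ + t) u)
      (exec A G hG pn t u)) (u : Fin n) :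
    exec A.toSet G hG pn (2 * Δ + t + 1) u =
      A.embed (pn.history Δ (2 * Δ) u) (exec A G hG pn (t + 1) u) := by
  classical
  have hdecode : A.decode ∘ (pn.recv Δ (sent A.toSet G hG pn (2 * Δ + t)) A.toSet.m₀ u) =
      pn.recv Δ (sent A G hG pn t) A.m₀ u := by
    have hsent : A.decode ∘ sent A.toSet G hG pn (2 * Δ + t) = sent A G hG pn t :=
      funext fun q => ((ih q.1).message _).1
    exact (pn.comp_recv Δ A.decode _ _ u).trans (by rw [hsent]; rfl)
  have hsome : ∀ q, sent A.toSet G hG pn (2 * Δ + t) q ≠ (none : Option (ℕ × ℕ × A.M)) →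
      sent A.toSet G hG pn (2 * Δ + t) q =
        (some (pn.history Δ (2 * Δ) q.1, (q.2 : ℕ), sent A G hG pn t q) :
          Option (ℕ × ℕ × A.M)) := fun q hq =>
    ((ih q.1).message _).2.resolve_left hq
  have hinj : InjOffNone (α := ℕ × ℕ × A.M)
      (pn.recv Δ (sent A.toSet G hG pn (2 * Δ + t)) A.toSet.m₀ u) := by
    intro k l hkl hk
    have hl := hkl ▸ hk
    obtain ⟨hk', ek⟩ := pn.recv_some (α := ℕ × ℕ × A.M) _ hk
    obtain ⟨hl', el⟩ := pn.recv_some (α := ℕ × ℕ × A.M) _ hl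
    have sk := hsome _ (fun h => hk (ek.trans h))
    have sl := hsome _ (fun h => hl (el.trans h))
    have e := (ek.trans sk).symm.trans (hkl.trans (el.trans sl))
    simp only [Option.some.injEq, Prod.mk.injEq] at e
    have hq := pn.port_ext hG (by simp only [Equiv.apply_symm_apply]) e.2.1 e.1
    have := pn.p.symm.injective hq
    simpa [Fin.ext_iff] using this
  have hδ : ∀ x, A.δ' x (A.decode ∘ vectorOfSet (α := ℕ × ℕ × A.M) (Set.range
      (pn.recv Δ (sent A.toSet G hG pn (2 * Δ + t)) A.toSet.m₀ u))) =
      A.δ' x (pn.recv Δ (sent A G hG pn t) A.m₀ u) := by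
    intro x
    refine hA.δ'_eq x _ _ ?_
    rw [← hdecode, ← List.map_ofFn, ← List.map_ofFn, ← Multiset.map_coe, ← Multiset.map_coe]
    exact congrArg (Multiset.map A.decode) (coe_ofFn_vectorOfSet hinj)
  have hactive : ∀ x, A.toSet.δ' (Sum.inr (0, pn.history Δ (2 * Δ) u, x))
      (pn.recv Δ (sent A.toSet G hG pn (2 * Δ + t)) A.toSet.m₀ u) =
      A.embed (pn.history Δ (2 * Δ) u)
        (A.δ' x (pn.recv Δ (sent A G hG pn t) A.m₀ u)) := by
    intro x
    rw [← hδ x]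
    change A.embed _ _ = _
    congr!
  rw [exec_succ, exec_succ A]
  rcases ih u with h | h
  · rw [h]
    cases exec A G hG pn t u with
    | inl y => rfl
    | inr z => exact hactive (Sum.inr z)
  · rw [h]
    exact hactive _

lemma exec_toSet_represents (hA : A.InMultiset) (t : ℕ) (u : Fin n) :
    Represents A (pn.history Δ (2 * Δ) u) (exec A.toSet G hG pn (2 * Δ + t) u)
      (exec A G hG pn t u) := by
  induction t generalizing u with
  | zero => exact Or.inr (exec_toSet_history A G hG pn (2 * Δ) 0 rfl u)
  | succ t ih => exact Or.inl (exec_toSet_step A G hG pn hA t ih u)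

end Simulation

lemma SolvesInTime.toSet {Y : Type} {A : ∀ Δ : ℕ, DSM Y Δ} {P : GraphProblem Y} {T : ℕ → ℕ → ℕ}
    (hA : ∀ Δ, (A Δ).InMultiset) (h : SolvesInTime A P T) :
    SolvesInTime (fun Δ => (A Δ).toSet) P fun Δ n => 2 * Δ + T Δ n + 1 := by
  intro Δ n G hG pn
  obtain ⟨S, hS, hout⟩ := h Δ n G hG pn
  refine ⟨S, hS, fun u => ?_⟩
  have := exec_toSet_step (A Δ) G hG pn (hA Δ) (T Δ n)
    (exec_toSet_represents (A Δ) G hG pn (hA Δ) (T Δ n)) u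
  rw [exec_succ (A Δ), hout u] at this
  exact this

/-- MV = SV and MV(1) = SV(1). -/
theorem MV_eq_SV : ∀ (Y : Type) [Fintype Y] (P : GraphProblem Y),
    (MV P ↔ SV P) ∧ (MV1 P ↔ SV1 P) := by
  intro Y _ P
  refine ⟨⟨?_, ?_⟩, ⟨?_, ?_⟩⟩
  · rintro ⟨A, hA, T, hT⟩
    exact ⟨fun Δ => (A Δ).toSet, fun Δ => (A Δ).toSet_inSet, _, hT.toSet hA⟩
  · rintro ⟨A, hA, T, hT⟩
    exact ⟨A, fun Δ => (hA Δ).inMultiset, T, hT⟩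
  · rintro ⟨A, hA, T, hT⟩
    exact ⟨fun Δ => (A Δ).toSet, fun Δ => (A Δ).toSet_inSet,
      fun Δ => 2 * Δ + T Δ + 1, hT.toSet hA⟩
  · rintro ⟨A, hA, T, hT⟩
    exact ⟨A, fun Δ => (hA Δ).inMultiset, T, hT⟩
end Weak
end

section
/- The problem classes satisfy VB=MB and VV=MV, and the constant-time classes satisfy VB(1)=MB(1) and VV(1)=MV(1). -/
namespace Weak

theorem sum_map_id_eq_inr {α β γ : Type*} {f : β → γ} {x : α ⊕ β} {c : γ}
    (h : x.map id f = Sum.inr c) : ∃ b, x = Sum.inr b ∧ f b = c := by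
  rcases x with a | b
  · cases h
  · exact ⟨b, rfl, Sum.inr.inj h⟩

theorem sum_map_id_eq_inl {α β γ : Type*} {f : β → γ} {x : α ⊕ β} {a : α}
    (h : x.map id f = Sum.inl a) : x = Sum.inl a := by
  rcases x with a | b
  · exact congrArg Sum.inl (Sum.inl.inj h)
  · cases h

theorem exists_perm_of_map_univ_eq {ι α : Type*} [Fintype ι] {f g : ι → α}
    (h : Finset.univ.val.map f = Finset.univ.val.map g) :
    ∃ σ : Equiv.Perm ι, ∀ i, f i = g (σ i) := by
  classical
  have fiber (a : α) : Nonempty ({i // f i = a} ≃ {i // g i = a}) := by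
    have hcount := congrArg (Multiset.count a) h
    rw [Multiset.count_map, Multiset.count_map] at hcount
    refine Fintype.card_eq.mp ?_
    simpa [Fintype.card_subtype, Finset.card_def, eq_comm] using hcount
  have e (a : α) := (fiber a).some
  refine ⟨(Equiv.sigmaFiberEquiv f).symm.trans
    ((Equiv.sigmaCongrRight e).trans (Equiv.sigmaFiberEquiv g)), fun i => (e (f i) ⟨i, rfl⟩).2.symm⟩

/-- A history together with the message that extends it, if such a message arrives. -/
def tag {α β : Type*} (x : α × Option β) : Option (α × β) :=
  x.2.map (Prod.mk x.1)

theorem eq_of_map_fst_eq_of_filterMap_tag_eq {α β : Type*} {s t : Multiset (α × Option β)}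
    (hfst : s.map Prod.fst = t.map Prod.fst) (htag : s.filterMap tag = t.filterMap tag) :
    s = t := by
  classical
  let P : α × Option β → Prop := fun x => x.2.isSome
  have some_part (s : Multiset (α × Option β)) :
      s.filter P = (s.filterMap tag).map (Prod.map id some) := by
    induction s using Multiset.induction with
    | empty => rfl
    | cons x s ih =>
      rcases x with ⟨a, _ | b⟩
      · rw [Multiset.filterMap_cons_none _ _ rfl, ← ih, Multiset.filter_cons_of_neg _ (by simp [P])]
      · rw [Multiset.filterMap_cons_some tag _ _ rfl, Multiset.map_cons, ← ih,
          Multiset.filter_cons_of_pos _ (by simp [P])]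
        rfl
  have none_part (s : Multiset (α × Option β)) :
      s.filter (fun x => ¬ P x) =
        ((s.filter fun x => ¬ P x).map Prod.fst).map fun a => (a, none) := by
    rw [Multiset.map_map]
    conv_lhs => rw [← Multiset.map_id (s.filter fun x => ¬ P x)]
    refine Multiset.map_congr rfl fun x hx => ?_
    have := (Multiset.mem_filter.mp hx).2
    rcases x with ⟨a, _ | b⟩ <;> simp_all [P]
  have hsome : s.filter P = t.filter P := by rw [some_part, some_part, htag]
  have hnone : s.filter (fun x => ¬ P x) = t.filter (fun x => ¬ P x) := by
    rw [none_part s, none_part t]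
    congr 1
    rw [← Multiset.filter_add_not P s, ← Multiset.filter_add_not P t, hsome,
      Multiset.map_add, Multiset.map_add] at hfst
    exact add_left_cancel hfst
  rw [← Multiset.filter_add_not P s, ← Multiset.filter_add_not P t, hsome, hnone]

theorem filterMap_ofFn_padded {α : Type*} {d Δ : ℕ} (hd : d ≤ Δ) (f : Fin d → Option α) :
    (List.ofFn fun k : Fin Δ => if h : (k : ℕ) < d then f ⟨k, h⟩ else none).filterMap id =
      (List.ofFn f).filterMap id := by
  obtain ⟨e, rfl⟩ := Nat.exists_eq_add_of_le hd
  simp [List.ofFn_add]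

open Classical in
/-- Assign the tagged messages in `r` to the ports whose histories are `L`: the choice is any
assignment compatible with the histories, and depends only on the multiset `r`. -/
noncomputable def assign {M : Type} {d : ℕ} (L : Fin d → List M)
    (r : Multiset (Option (List M × M))) : Fin d → Option M :=
  if h : ∃ o : Fin d → Option M,
      (Finset.univ.val.map fun k => (L k, o k)).filterMap tag = r.filterMap id
  then h.choose else fun _ => none

theorem exists_perm_assign {M : Type} {d : ℕ} {L h : Fin d → List M} {o : Fin d → Option M}
    {r : Multiset (Option (List M × M))} {σ : Equiv.Perm (Fin d)} (hσ : ∀ k, L k = h (σ k))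
    (hr : r.filterMap id = (Finset.univ.val.map fun k => (h k, o k)).filterMap tag) :
    ∃ τ : Equiv.Perm (Fin d), ∀ k, L k = h (τ k) ∧ assign L r k = o (τ k) := by
  have map_perm {α : Type} (f : Fin d → α) :
      Finset.univ.val.map (fun k => f (σ k)) = Finset.univ.val.map f := by
    conv_rhs => rw [← Multiset.map_univ_val_equiv σ, Multiset.map_map]
    rfl
  have hex : ∃ o : Fin d → Option M,
      (Finset.univ.val.map fun k => (L k, o k)).filterMap tag = r.filterMap id :=
    ⟨fun k => o (σ k), by simp only [hσ, hr]; rw [map_perm fun k => (h k, o k)]⟩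
  have hassign : (Finset.univ.val.map fun k => (L k, assign L r k)).filterMap tag =
      r.filterMap id := by
    rw [assign, dif_pos hex]
    exact hex.choose_spec
  obtain ⟨τ, hτ⟩ := exists_perm_of_map_univ_eq <| eq_of_map_fst_eq_of_filterMap_tag_eq
    (s := Finset.univ.val.map fun k => (L k, assign L r k))
    (t := Finset.univ.val.map fun k => (h k, o k))
    (by simpa [Multiset.map_map, Function.comp_def, hσ] using map_perm h) (hassign.trans hr)
  exact ⟨τ, fun k => Prod.ext_iff.mp (hτ k)⟩

/-- The state of the simulation of a machine: the simulated state, the list of its previous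
states (latest first), the degree, and the message histories attributed to the ports. -/
structure SimState (Z M : Type) where
  state : Z
  past : List Z
  degree : ℕ
  hist : Fin degree → List M

/-- The simulation of a machine by one that ignores the order of the incoming messages. -/
noncomputable def DSM.sim {Y : Type} {Δ : ℕ} (A : DSM Y Δ) : DSM Y Δ where
  Z := SimState A.Z A.M
  z₀ d := (A.z₀ d).map id fun z => ⟨z, [], d, fun _ => []⟩
  M := Option (List A.M × A.M)
  m₀ := none
  μ s i := some (s.past.map (A.μ · i), A.μ s.state i)
  δ s r :=
    let c k := (assign s.hist (List.ofFn r) k).getD A.m₀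
    (A.δ s.state fun k => if h : (k : ℕ) < s.degree then c ⟨k, h⟩ else A.m₀).map id
      fun z => ⟨z, s.state :: s.past, s.degree, fun k => c k :: s.hist k⟩

theorem DSM.sim_inMultiset {Y : Type} {Δ : ℕ} (A : DSM Y Δ) : A.sim.InMultiset := by
  intro s a b hab
  simp only [DSM.sim] at hab ⊢
  rw [hab]

theorem DSM.sim_inBroadcast {Y : Type} {Δ : ℕ} {A : DSM Y Δ} (hA : A.InBroadcast) :
    A.sim.InBroadcast := by
  intro s i j
  simp only [DSM.sim, fun z => hA z i j]

/-- Renumber the incoming ports at every node. -/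
def PortNumbering.permute {n : ℕ} {G : SimpleGraph (Fin n)} (pn : PortNumbering G)
    (σ : ∀ u, Equiv.Perm (Fin (deg G u))) : PortNumbering G where
  p := pn.p.trans (Equiv.sigmaCongrRight σ).symm
  adj := pn.adj

section Simulation

variable {Y : Type} {Δ n : ℕ} (A : DSM Y Δ) (G : SimpleGraph (Fin n))
  (hG : ∀ v, deg G v ≤ Δ) (pn : PortNumbering G)

/-- The simulated execution. -/
noncomputable def simExec (t : ℕ) (u : Fin n) : Y ⊕ A.Z :=
  (exec A.sim G hG pn t u).map id SimState.state

/-- The simulated messages sent through outgoing ports before time `t`, latest first. -/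
noncomputable def simHist : ℕ → (q : Port G) → List A.M
  | 0, _ => []
  | t + 1, q => A.μ' (simExec A G hG pn t q.1) (q.2.castLE (hG _)) :: simHist t q

/-- The vector of messages received by `u` in the simulating execution. -/
noncomputable def simReceived (t : ℕ) (u : Fin n) (k : Fin Δ) : Option (List A.M × A.M) :=
  if h : (k : ℕ) < deg G u then
    A.sim.μ' (exec A.sim G hG pn t (pn.p.symm ⟨u, ⟨k, h⟩⟩).1)
      ((pn.p.symm ⟨u, ⟨k, h⟩⟩).2.castLE (hG _))
  else none

variable {A G hG pn}

theorem simExec_of_inl {t : ℕ} {u : Fin n} {y : Y}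
    (hy : exec A.sim G hG pn t u = Sum.inl y) : simExec A G hG pn t u = Sum.inl y := by
  rw [simExec, hy]
  rfl

theorem simExec_of_inr {t : ℕ} {u : Fin n} {s : SimState A.Z A.M}
    (hs : exec A.sim G hG pn t u = Sum.inr s) :
    simExec A G hG pn t u = Sum.inr s.state := by
  rw [simExec, hs]
  rfl

theorem exec_sim_succ {t : ℕ} {u : Fin n} {s : A.sim.Z}
    (hs : exec A.sim G hG pn t u = Sum.inr s) :
    exec A.sim G hG pn (t + 1) u = A.sim.δ s (simReceived A G hG pn t u) := by
  rw [exec, hs]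
  rfl

theorem exec_sim_succ_of_stopped {t : ℕ} {u : Fin n} {y : Y}
    (hy : exec A.sim G hG pn t u = Sum.inl y) :
    exec A.sim G hG pn (t + 1) u = Sum.inl y := by
  rw [exec, hy]
  rfl

theorem exec_sim_succ_eq_inr {t : ℕ} {u : Fin n} {s' : SimState A.Z A.M}
    (hs' : exec A.sim G hG pn (t + 1) u = Sum.inr s') :
    ∃ s : SimState A.Z A.M, exec A.sim G hG pn t u = Sum.inr s ∧
      ∃ z, s' = ⟨z, s.state :: s.past, s.degree, fun k =>
        (assign s.hist (List.ofFn (simReceived A G hG pn t u)) k).getD A.m₀ :: s.hist k⟩ := by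
  rcases hs : exec A.sim G hG pn t u with y | s
  · rw [exec_sim_succ_of_stopped hs] at hs'
    cases hs'
  · refine ⟨s, rfl, ?_⟩
    rw [exec_sim_succ hs] at hs'
    simp only [DSM.sim] at hs'
    obtain ⟨z, -, hz⟩ := sum_map_id_eq_inr hs'
    exact ⟨z, hz.symm⟩

theorem exec_sim_zero_eq_inr {u : Fin n} {s : SimState A.Z A.M}
    (hs : exec A.sim G hG pn 0 u = Sum.inr s) :
    ∃ z, s = ⟨z, [], deg G u, fun _ => []⟩ := by
  simp only [exec, DSM.sim] at hs
  obtain ⟨z, -, hz⟩ := sum_map_id_eq_inr hs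
  exact ⟨z, hz.symm⟩

theorem degree_eq {t : ℕ} {u : Fin n} {s : SimState A.Z A.M}
    (hs : exec A.sim G hG pn t u = Sum.inr s) : s.degree = deg G u := by
  induction t generalizing s with
  | zero =>
    obtain ⟨z, rfl⟩ := exec_sim_zero_eq_inr hs
    rfl
  | succ t ih =>
    obtain ⟨s₀, hs₀, z, rfl⟩ := exec_sim_succ_eq_inr hs
    exact ih (s := s₀) hs₀

theorem past_map_eq_simHist {t : ℕ} {q : Port G} {s : SimState A.Z A.M}
    (hs : exec A.sim G hG pn t q.1 = Sum.inr s) :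
    s.past.map (A.μ · (q.2.castLE (hG _))) = simHist A G hG pn t q := by
  induction t generalizing s with
  | zero =>
    obtain ⟨z, rfl⟩ := exec_sim_zero_eq_inr hs
    rfl
  | succ t ih =>
    obtain ⟨s₀, hs₀, z, rfl⟩ := exec_sim_succ_eq_inr hs
    simp only [simHist, ← ih hs₀, simExec_of_inr hs₀, DSM.μ', List.map_cons]

theorem eq_of_simHist_eq {T : ℕ} {q q' : Port G}
    (h : simHist A G hG pn T q = simHist A G hG pn T q') {t : ℕ} (ht : t < T) :
    A.μ' (simExec A G hG pn t q.1) (q.2.castLE (hG _)) =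
      A.μ' (simExec A G hG pn t q'.1) (q'.2.castLE (hG _)) := by
  induction T with
  | zero => omega
  | succ T ih =>
    obtain ⟨hm, hh⟩ := List.cons.inj h
    rcases Nat.lt_succ_iff_lt_or_eq.mp ht with ht | rfl
    · exact ih hh ht
    · exact hm

/-- The simulated message leaving an outgoing port, absent if the node has stopped. -/
noncomputable def simMessage (A : DSM Y Δ) (G : SimpleGraph (Fin n))
    (hG : ∀ v, deg G v ≤ Δ) (pn : PortNumbering G) (t : ℕ) (q : Port G) : Option A.M :=
  (simExec A G hG pn t q.1).elim (fun _ => none) fun z => some (A.μ z (q.2.castLE (hG _)))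

theorem simMessage_getD (t : ℕ) (q : Port G) :
    (simMessage A G hG pn t q).getD A.m₀ =
      A.μ' (simExec A G hG pn t q.1) (q.2.castLE (hG _)) := by
  unfold simMessage
  rcases simExec A G hG pn t q.1 <;> rfl

theorem sim_μ'_exec (t : ℕ) (q : Port G) :
    A.sim.μ' (exec A.sim G hG pn t q.1) (q.2.castLE (hG _)) =
      tag (simHist A G hG pn t q, simMessage A G hG pn t q) := by
  rcases hs : exec A.sim G hG pn t q.1 with y | s
  · rw [simMessage, simExec_of_inl hs]
    rfl
  · rw [simMessage, simExec_of_inr hs, ← past_map_eq_simHist hs]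
    rfl

theorem filterMap_simReceived (t : ℕ) (u : Fin n) :
    (List.ofFn (simReceived A G hG pn t u) : Multiset (Option (List A.M × A.M))).filterMap id =
      (Finset.univ.val.map fun k : Fin (deg G u) =>
        (simHist A G hG pn t (pn.p.symm ⟨u, k⟩),
          simMessage A G hG pn t (pn.p.symm ⟨u, k⟩))).filterMap tag := by
  rw [Multiset.filterMap_coe]
  unfold simReceived
  rw [filterMap_ofFn_padded (hG u) fun k =>
    A.sim.μ' (exec A.sim G hG pn t (pn.p.symm ⟨u, k⟩).1)
      ((pn.p.symm ⟨u, k⟩).2.castLE (hG _))]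
  simp only [sim_μ'_exec]
  rw [← Multiset.filterMap_coe, ← Fin.univ_val_map, Multiset.filterMap_map,
    Multiset.filterMap_map]
  rfl

/-- A single renumbering of the incoming ports explains all choices made up to time `T`. -/
theorem exists_perm_consistent (T : ℕ) (u : Fin n) :
    ∃ σ : Equiv.Perm (Fin (deg G u)),
      (∀ t < T, ∀ z past L,
        exec A.sim G hG pn t u = Sum.inr (SimState.mk z past (deg G u) L) → ∀ k,
        (assign L (List.ofFn (simReceived A G hG pn t u)) k).getD A.m₀ =
          A.μ' (simExec A G hG pn t (pn.p.symm ⟨u, σ k⟩).1)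
            ((pn.p.symm ⟨u, σ k⟩).2.castLE (hG _))) ∧
      ∀ z past L, exec A.sim G hG pn T u = Sum.inr (SimState.mk z past (deg G u) L) →
        ∀ k, L k = simHist A G hG pn T (pn.p.symm ⟨u, σ k⟩) := by
  induction T with
  | zero =>
    refine ⟨1, by simp, fun z past L hs k => ?_⟩
    obtain ⟨z, hz⟩ := exec_sim_zero_eq_inr hs
    cases hz
    rfl
  | succ T ih =>
    obtain ⟨σ, hmsg, hhist⟩ := ih
    rcases hs : exec A.sim G hG pn T u with y | s
    · refine ⟨σ, fun t ht z past L hs' => ?_, fun z past L hs' => ?_⟩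
      · rcases Nat.lt_succ_iff_lt_or_eq.mp ht with ht | rfl
        · exact hmsg t ht z past L hs'
        · simp [hs] at hs'
      · rw [exec_sim_succ_of_stopped hs] at hs'
        cases hs'
    · obtain ⟨z₀, past₀, d, L₀⟩ := s
      obtain rfl : d = deg G u := degree_eq hs
      obtain ⟨τ, hτ⟩ := exists_perm_assign
        (h := fun k => simHist A G hG pn T (pn.p.symm ⟨u, k⟩))
        (o := fun k => simMessage A G hG pn T (pn.p.symm ⟨u, k⟩))
        (hhist z₀ past₀ L₀ hs) (filterMap_simReceived T u)
      have hτmsg (k) : (assign L₀ (List.ofFn (simReceived A G hG pn T u)) k).getD A.m₀ =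
          A.μ' (simExec A G hG pn T (pn.p.symm ⟨u, τ k⟩).1)
            ((pn.p.symm ⟨u, τ k⟩).2.castLE (hG _)) := by
        rw [(hτ k).2, simMessage_getD]
      refine ⟨τ, fun t ht z past L hs' k => ?_, fun z past L hs' k => ?_⟩
      · rcases Nat.lt_succ_iff_lt_or_eq.mp ht with ht | rfl
        · rw [hmsg t ht z past L hs' k]
          exact eq_of_simHist_eq ((hhist z₀ past₀ L₀ hs k).symm.trans (hτ k).1) ht
        · rw [hs] at hs'
          cases hs'
          exact hτmsg k
      · obtain ⟨s, hs₁, z₁, hz₁⟩ := exec_sim_succ_eq_inr hs'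
        rw [hs] at hs₁
        cases hs₁
        cases hz₁
        simp only [simHist]
        rw [hτmsg, (hτ k).1]

/-- Up to any given time, the simulated execution is an execution of the original machine. -/
theorem exists_simExec_eq_exec (A : DSM Y Δ) (G : SimpleGraph (Fin n))
    (hG : ∀ v, deg G v ≤ Δ) (pn : PortNumbering G) (T : ℕ) :
    ∃ pn' : PortNumbering G, ∀ t ≤ T, ∀ u, simExec A G hG pn t u = exec A G hG pn' t u := by
  choose σ hσ using fun u => exists_perm_consistent (A := A) (hG := hG) (pn := pn) T u
  refine ⟨pn.permute σ, fun t => ?_⟩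
  induction t with
  | zero =>
    intro _ u
    simp only [simExec, exec, DSM.sim, Sum.map_map]
    exact congrFun Sum.map_id_id _
  | succ t ih =>
    intro ht u
    have ih := ih (by omega)
    rw [exec, ← ih u]
    rcases hs : exec A.sim G hG pn t u with y | s
    · rw [simExec_of_inl hs, simExec_of_inl (exec_sim_succ_of_stopped hs)]
      rfl
    · obtain ⟨z, past, d, L⟩ := s
      obtain rfl : d = deg G u := degree_eq hs
      have hmsg := (hσ u).1 t (by omega) z past L hs
      rw [simExec_of_inr hs, simExec, exec_sim_succ hs]
      simp only [DSM.sim, Sum.map_map, DSM.δ']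
      refine (congrFun Sum.map_id_id _).trans ?_
      refine congrArg (A.δ z) (funext fun k => ?_)
      split_ifs with hk
      · rw [hmsg, ← ih]
        rfl
      · rfl

end Simulation

theorem SolvesInTime.sim {Y : Type} {A : ∀ Δ : ℕ, DSM Y Δ} {P : GraphProblem Y}
    {T : ℕ → ℕ → ℕ} (hA : SolvesInTime A P T) : SolvesInTime (fun Δ => (A Δ).sim) P T := by
  intro Δ n G hG pn
  obtain ⟨pn', hpn'⟩ := exists_simExec_eq_exec (A Δ) G hG pn (T Δ n)
  obtain ⟨S, hS, hexec⟩ := hA Δ n G hG pn'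
  refine ⟨S, hS, fun u => ?_⟩
  have hu := (hpn' _ le_rfl u).trans (hexec u)
  exact sum_map_id_eq_inl hu

/-- VB = MB, VV = MV, VB(1) = MB(1), and VV(1) = MV(1). -/
theorem VB_eq_MB_and_VV_eq_MV : ∀ (Y : Type) [Fintype Y] (P : GraphProblem Y),
    (VB P ↔ MB P) ∧ (VV P ↔ MV P) ∧ (VB1 P ↔ MB1 P) ∧ (VV1 P ↔ MV1 P) := by
  intro Y _ P
  refine ⟨⟨?_, ?_⟩, ⟨?_, ?_⟩, ⟨?_, ?_⟩, ⟨?_, ?_⟩⟩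
  · rintro ⟨A, hA, T, hT⟩
    exact ⟨_, fun Δ => ⟨(A Δ).sim_inMultiset, DSM.sim_inBroadcast (hA Δ)⟩, T, hT.sim⟩
  · rintro ⟨A, hA, T, hT⟩
    exact ⟨A, fun Δ => (hA Δ).2, T, hT⟩
  · rintro ⟨A, T, hT⟩
    exact ⟨_, fun Δ => (A Δ).sim_inMultiset, T, hT.sim⟩
  · rintro ⟨A, -, T, hT⟩
    exact ⟨A, T, hT⟩
  · rintro ⟨A, hA, T, hT⟩
    exact ⟨_, fun Δ => ⟨(A Δ).sim_inMultiset, DSM.sim_inBroadcast (hA Δ)⟩, T, hT.sim⟩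
  · rintro ⟨A, hA, T, hT⟩
    exact ⟨A, fun Δ => (hA Δ).2, T, hT⟩
  · rintro ⟨A, T, hT⟩
    exact ⟨_, fun Δ => (A Δ).sim_inMultiset, T, hT.sim⟩
  · rintro ⟨A, -, T, hT⟩
    exact ⟨A, T, hT⟩

end Weak
end

section
/- Let Π be the graph problem with outputs Y={0,1} defined by: S∈Π(G) iff for every node v, S(v)=1 exactly when v has an odd number of neighbours of odd degree. Then Π∈MB(1) but Π∉SB. -/
namespace Weak
/-- The problem of identifying nodes with an odd number of neighbours of odd degree. -/
def oddOddProblem : GraphProblem Bool := fun n G =>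
  { S | ∀ v : Fin n,
      S v = true ↔ Odd (Nat.card {u : Fin n // G.Adj v u ∧ Odd (deg G u)}) }

namespace PortNumbering

variable {n : ℕ} {G : SimpleGraph (Fin n)}

theorem adj_symm_fst (pn : PortNumbering G) (q : Port G) : G.Adj q.1 (pn.p.symm q).1 :=
  ((pn.adj _ _).1 ⟨(pn.p.symm q).2, by simp⟩).symm

theorem exists_symm_fst_eq (pn : PortNumbering G) {u w : Fin n} (h : G.Adj u w) :
    ∃ k : Fin (deg G u), (pn.p.symm ⟨u, k⟩).1 = w := by
  obtain ⟨i, rfl⟩ := (pn.adj w u).2 h.symm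
  exact ⟨(pn.p ⟨w, i⟩).2, by simp⟩

/-- The ports of a node correspond bijectively to the neighbours sending to them. -/
noncomputable def senderEquiv (pn : PortNumbering G) (u : Fin n) :
    Fin (deg G u) ≃ {w : Fin n // G.Adj u w} :=
  Equiv.ofBijective (fun k => ⟨(pn.p.symm ⟨u, k⟩).1, pn.adj_symm_fst ⟨u, k⟩⟩)
    (Function.Surjective.bijective_of_nat_card_le
      (fun w => (pn.exists_symm_fst_eq w.2).imp fun _ hk => Subtype.ext hk) (by simp [deg]))

/-- Every graph has a port numbering. -/
theorem nonempty (G : SimpleGraph (Fin n)) : Nonempty (PortNumbering G) := by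
  have e (v : Fin n) : Fin (deg G v) ≃ {u : Fin n // G.Adj v u} := (Finite.equivFin _).symm
  let swap : (Σ v, {u : Fin n // G.Adj v u}) ≃ Σ v, {u : Fin n // G.Adj v u} :=
    { toFun := fun d => ⟨d.2.1, d.1, d.2.2.symm⟩
      invFun := fun d => ⟨d.2.1, d.1, d.2.2.symm⟩
      left_inv := fun _ => rfl
      right_inv := fun _ => rfl }
  refine ⟨⟨((Equiv.sigmaCongrRight e).trans swap).trans (Equiv.sigmaCongrRight e).symm,
    fun u v => ⟨?_, fun h => ⟨(e u).symm ⟨v, h⟩, ?_⟩⟩⟩⟩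
  · rintro ⟨i, rfl⟩
    exact (e u i).2
  · simp [swap, Equiv.sigmaCongrRight]

end PortNumbering

section Bisimulation

variable {Y : Type} {Δ n : ℕ}

theorem DSM.InBroadcast.μ'_eq {A : DSM Y Δ} (hA : A.InBroadcast) (x : Y ⊕ A.Z) (i j : Fin Δ) :
    A.μ' x i = A.μ' x j := by
  cases x with
  | inl y => rfl
  | inr z => exact hA z i j

theorem DSM.InSet.δ'_eq {A : DSM Y Δ} (hA : A.InSet) (x : Y ⊕ A.Z) {a b : Fin Δ → A.M}
    (h : Set.range a = Set.range b) : A.δ' x a = A.δ' x b := by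
  cases x with
  | inl y => rfl
  | inr z => exact hA z a b h

/-- Nodes that are identified by a colouring stable under degrees and sets of neighbouring colours
are indistinguishable for machines in Set ∩ Broadcast. -/
theorem exec_eq_of_bisimulation {A : DSM Y Δ} (hS : A.InSet) (hB : A.InBroadcast)
    {G : SimpleGraph (Fin n)} (hG : ∀ v, deg G v ≤ Δ) (pn : PortNumbering G) {γ : Type}
    (c : Fin n → γ) (hdeg : ∀ u v, c u = c v → deg G u = deg G v)
    (hadj : ∀ u v, c u = c v → ∀ w, G.Adj u w → ∃ w', G.Adj v w' ∧ c w = c w') (t : ℕ) :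
    ∀ u v, c u = c v → exec A G hG pn t u = exec A G hG pn t v := by
  induction t with
  | zero =>
    intro u v h
    simp only [exec, hdeg u v h]
  | succ t ih =>
    have key : ∀ u v, c u = c v →
        Set.range (fun k : Fin Δ => if h : (k : ℕ) < deg G u then
          A.μ' (exec A G hG pn t (pn.p.symm ⟨u, ⟨(k : ℕ), h⟩⟩).1)
            ⟨((pn.p.symm ⟨u, ⟨(k : ℕ), h⟩⟩).2 : ℕ),
              lt_of_lt_of_le (pn.p.symm ⟨u, ⟨(k : ℕ), h⟩⟩).2.isLt (hG _)⟩
        else A.m₀) ⊆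
        Set.range (fun k : Fin Δ => if h : (k : ℕ) < deg G v then
          A.μ' (exec A G hG pn t (pn.p.symm ⟨v, ⟨(k : ℕ), h⟩⟩).1)
            ⟨((pn.p.symm ⟨v, ⟨(k : ℕ), h⟩⟩).2 : ℕ),
              lt_of_lt_of_le (pn.p.symm ⟨v, ⟨(k : ℕ), h⟩⟩).2.isLt (hG _)⟩
        else A.m₀) := by
      rintro u v huv _ ⟨k, rfl⟩
      by_cases hk : (k : ℕ) < deg G u
      · obtain ⟨w, hw, hcw⟩ := hadj u v huv _ (pn.adj_symm_fst ⟨u, ⟨k, hk⟩⟩)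
        obtain ⟨l, rfl⟩ := pn.exists_symm_fst_eq hw
        refine ⟨⟨l, l.2.trans_le (hG v)⟩, ?_⟩
        simp only [hk, l.2, dite_true]
        rw [ih _ _ hcw]
        exact hB.μ'_eq _ _ _
      · exact ⟨k, by simp only [hk, hdeg u v huv ▸ hk, dite_false]⟩
    intro u v h
    simp only [exec]
    rw [ih u v h]
    exact hS.δ'_eq _ ((key u v h).antisymm (key v u h.symm))

end Bisimulation

/-- The machine that broadcasts degree parity and outputs the parity of the number of
odd messages. -/
noncomputable def oddOddMachine (Δ : ℕ) : DSM Bool Δ where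
  Z := Bool
  z₀ d := Sum.inr (decide (Odd (d : ℕ)))
  M := Bool
  m₀ := false
  μ z _ := z
  δ _ a := Sum.inl (decide (Odd ((List.ofFn a : Multiset Bool).count true)))

theorem MB1_oddOddProblem : MB1 oddOddProblem := by
  refine ⟨oddOddMachine, fun Δ => ⟨fun z a b h => ?_, fun _ _ _ => rfl⟩, fun _ => 1, ?_⟩
  · exact congrArg (fun s : Multiset Bool => (Sum.inl (decide (Odd (s.count true))) : Bool ⊕ Bool)) h
  intro Δ n G hG pn
  refine ⟨fun v => decide (Odd (Nat.card {u : Fin n // G.Adj v u ∧ Odd (deg G u)})),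
    fun v => by simp, fun u => ?_⟩
  simp only [exec, DSM.δ', DSM.μ', oddOddMachine]
  congr 3
  rw [← Fin.univ_val_map, Multiset.count_map, ← Finset.filter_val, Finset.card_val,
    ← Fintype.card_subtype, ← Nat.card_eq_fintype_card]
  refine Nat.card_congr ?_
  refine Equiv.trans ?_ (Equiv.subtypeSubtypeEquivSubtypeInter _ _)
  refine Equiv.trans ?_ ((pn.senderEquiv u).subtypeEquiv (p := fun k =>
    Odd (deg G (pn.senderEquiv u k))) fun _ => Iff.rfl)
  refine
    { toFun := fun k => ⟨⟨k.1, ?_⟩, ?_⟩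
      invFun := fun k => ⟨⟨k.1, k.1.2.trans_le (hG u)⟩, ?_⟩
      left_inv := fun _ => rfl
      right_inv := fun _ => rfl }
  · by_contra h
    simpa [h] using k.2
  · have h := k.2
    split_ifs at h with hk
    simpa [PortNumbering.senderEquiv] using h
  · simpa [PortNumbering.senderEquiv] using k.2

/-- A path `0, 1, 2, 3` of nodes of degree three, completed by three nodes of degree two. -/
def pathGadget : SimpleGraph (Fin 7) where
  Adj u v :=
    (u, v) ∈ [(0, 1), (1, 2), (2, 3), (0, 4), (1, 4), (2, 5), (3, 5), (0, 6), (3, 6)] ∨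
    (v, u) ∈ [(0, 1), (1, 2), (2, 3), (0, 4), (1, 4), (2, 5), (3, 5), (0, 6), (3, 6)]
  symm := ⟨fun _ _ h => h.symm⟩
  loopless := ⟨by decide⟩

instance : DecidableRel pathGadget.Adj := fun u v => by
  unfold pathGadget
  infer_instance

theorem deg_pathGadget (v : Fin 7) : deg pathGadget v = if v < 4 then 3 else 2 := by
  rw [deg, Nat.card_eq_fintype_card]
  revert v
  decide

theorem not_SB_oddOddProblem : ¬ SB oddOddProblem := by
  rintro ⟨A, hA, T, hT⟩
  obtain ⟨pn⟩ := PortNumbering.nonempty pathGadget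
  have hG : ∀ v, deg pathGadget v ≤ 3 := by
    simp only [deg_pathGadget]
    decide
  obtain ⟨S, hS, hrun⟩ := hT 3 7 pathGadget hG pn
  have h01 := exec_eq_of_bisimulation (hA 3).1 (hA 3).2 hG pn (fun v => decide (v < 4))
    (by simp only [deg_pathGadget]; decide) (by decide) (T 3 7) 0 1 rfl
  rw [hrun, hrun, Sum.inl.injEq] at h01
  have h0 := hS 0
  have h1 := hS 1
  rw [h01] at h0
  have h := h0.symm.trans h1
  simp only [deg_pathGadget, Nat.card_eq_fintype_card] at h
  revert h
  decide

/-- The odd-odd problem is in MB(1) but not in SB. -/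
theorem oddOddProblem_MB1_not_SB : MB1 oddOddProblem ∧ ¬ SB oddOddProblem :=
  ⟨MB1_oddOddProblem, not_SB_oddOddProblem⟩
end Weak
end
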